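/- arXiv:1901.05730 — 4 statements merged into one kernel-verified Lean document; each statement's English description precedes it below -/
import Mathlib

section
/- Let E be a division ring which is a finite-dimensional ℚ-algebra whose center Z(E) has degree n over ℚ and with dim_ℚ E = n·m². Let O be an order in E and let l be a rational prime. Then every subring of the quotient ring O/lO which is a division ring has dimension at most n·m as an F_l-vector space. -/
open scoped TensorProduct

lemma aux_indep {K L E ι : Type*} [Field K] [Field L] [DivisionRing E] [Algebra K L] [Algebra K E]
    [Module L E] [IsScalarTower K L E] [IsScalarTower L E E]
    (hc : ∀ x : E, (∀ y, y * x = x * y) → ∃ c : K, algebraMap K E c = x)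
    (a : ι → L) (ha : LinearIndependent K a) (s : Finset ι) :
    ∀ b : ι → E, (∀ x : E, ∑ i ∈ s, a i • (x * b i) = 0) → ∀ i ∈ s, b i = 0 := by
  classical
  induction s using Finset.induction_on with
  | empty => simp
  | insert j s hj ih =>
    intro b hb
    by_cases hbj : b j = 0
    · intro i hi
      rcases Finset.mem_insert.1 hi with rfl | hi
      · exact hbj
      · refine ih b (fun x => ?_) i hi
        have := hb x
        rwa [Finset.sum_insert hj, hbj, mul_zero, smul_zero, zero_add] at this
    · exfalso
      set d : ι → E := fun i => b i * (b j)⁻¹ with hd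
      have hd1 : d j = 1 := mul_inv_cancel₀ hbj
      have hds : ∀ x y : E, ∑ i ∈ insert j s, a i • (x * (d i * y)) = 0 := by
        intro x y
        have := congrArg (· * ((b j)⁻¹ * y)) (hb x)
        simp only [Finset.sum_mul, zero_mul, smul_mul_assoc] at this
        rw [← this]
        refine Finset.sum_congr rfl fun i _ => ?_
        simp only [hd, mul_assoc]
      have hcen : ∀ i ∈ insert j s, ∃ c : K, algebraMap K E c = d i := by
        intro i hi
        rcases Finset.mem_insert.1 hi with rfl | hi
        · exact ⟨1, by simp [hd1]⟩
        refine hc _ fun y => ?_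
        rw [← sub_eq_zero]
        refine ih (fun i => y * d i - d i * y) (fun x => ?_) i hi
        have h1 := hds x y
        have h2 := hds (x * y) 1
        have h3 : ∑ i ∈ insert j s, a i • (x * (y * d i - d i * y)) = 0 := by
          simp only [mul_sub, smul_sub, Finset.sum_sub_distrib]
          rw [h1, sub_zero, ← h2]
          simp [mul_assoc]
        rwa [Finset.sum_insert hj, hd1, mul_one, one_mul, sub_self, mul_zero, smul_zero,
          zero_add] at h3
      choose! c hcd using hcen
      have h1 := hds 1 1
      have h2 : (∑ i ∈ insert j s, c i • a i) • (1 : E) = 0 := by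
        rw [← h1, Finset.sum_smul]
        refine Finset.sum_congr rfl fun i hi => ?_
        rw [← hcd i hi, mul_one, one_mul, Algebra.algebraMap_eq_smul_one, smul_assoc,
          smul_algebra_smul_comm (c i) (a i) (1 : E)]
      have h3 := (smul_eq_zero.1 h2).resolve_right one_ne_zero
      have h4 := linearIndependent_iff'.1 ha _ _ h3 j (Finset.mem_insert_self _ _)
      have h5 := hcd j (Finset.mem_insert_self _ _)
      rw [h4, hd1, map_zero] at h5
      exact zero_ne_one h5

lemma aux_sq {K L E : Type*} [Field K] [Field L] [DivisionRing E] [Algebra K L] [Algebra K E]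
    [Module L E] [IsScalarTower K L E] [IsScalarTower L E E] [FiniteDimensional K E]
    [FiniteDimensional K L]
    (hc : ∀ x : E, (∀ y, y * x = x * y) → ∃ c : K, algebraMap K E c = x) :
    Module.finrank K L ^ 2 ≤ Module.finrank K E := by
  have : FiniteDimensional L E := Module.Finite.of_restrictScalars_finite K L E
  let B := Module.finBasis K L
  let T : (Fin (Module.finrank K L) → E) →ₗ[K] (E →ₗ[L] E) :=
    { toFun := fun b =>
        { toFun := fun x => ∑ i, B i • (x * b i)
          map_add' := by intro x y; simp [add_mul, Finset.sum_add_distrib]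
          map_smul' := by
            intro r x
            simp only [smul_mul_assoc, Finset.smul_sum, RingHom.id_apply]
            exact Finset.sum_congr rfl fun i _ => smul_comm _ _ _ }
      map_add' := by
        intro x y; ext z; simp [mul_add, Finset.sum_add_distrib]
      map_smul' := by
        intro r x; ext z
        simp only [Pi.smul_apply, mul_smul_comm, LinearMap.coe_mk, AddHom.coe_mk,
          RingHom.id_apply, LinearMap.smul_apply, Finset.smul_sum]
        exact Finset.sum_congr rfl fun i _ => smul_algebra_smul_comm _ _ _ }
  have hT : Function.Injective T := by
    rw [injective_iff_map_eq_zero]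
    intro b hb
    funext i
    exact aux_indep hc B B.linearIndependent Finset.univ b
      (fun x => LinearMap.congr_fun hb x) i (Finset.mem_univ i)
  have : FiniteDimensional K (E →ₗ[L] E) := Module.Finite.trans L _
  have h := LinearMap.finrank_le_finrank_of_injective hT
  rw [Module.finrank_pi_fintype, Finset.sum_const, Finset.card_univ, Fintype.card_fin,
    smul_eq_mul, ← Module.finrank_mul_finrank K L (E →ₗ[L] E), Module.finrank_linearMap] at h
  have hk : 0 < Module.finrank K L := Module.finrank_pos
  have hq : 0 < Module.finrank L E := Module.finrank_pos
  rw [← Module.finrank_mul_finrank K L E] at h ⊢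
  have h' := Nat.le_of_mul_le_mul_left h hk
  rw [sq]
  exact Nat.mul_le_mul_left _ (Nat.le_of_mul_le_mul_right h' hq)

lemma aux_field {E : Type*} [DivisionRing E] [Algebra ℚ E] [FiniteDimensional ℚ E]
    (n m : ℕ) (hn : Module.finrank ℚ (Subalgebra.center ℚ E) = n)
    (hdim : Module.finrank ℚ E = n * m ^ 2) (a : E) (ha : IsIntegral ℤ a) :
    ∃ P : Polynomial ℤ, P.Monic ∧ P.natDegree ≤ n * m ∧ Polynomial.aeval a P = 0 := by
  let Z := Subalgebra.center ℚ E
  let : Field Z := fieldOfFiniteDimensional ℚ Z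
  let : Algebra Z E :=
    { smul := (· • ·)
      algebraMap := Z.val.toRingHom
      commutes' := fun r x => (Subalgebra.mem_center_iff.1 r.2 x).symm
      smul_def' := fun _ _ => rfl }
  have : IsScalarTower ℚ Z E := ⟨fun r z x => smul_mul_assoc r (z : E) x⟩
  let : FiniteDimensional Z E := Module.Finite.of_restrictScalars_finite ℚ Z E
  let L := Algebra.adjoin Z {a}
  have : IsMulCommutative L := Algebra.isMulCommutative_adjoin Z (s := {a}) (by simp)
  have : IsDomain L := Function.Injective.isDomain L.val.toRingHom Subtype.val_injective
  let : Field L := fieldOfFiniteDimensional Z L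
  have h1 : Module.finrank Z L ^ 2 ≤ Module.finrank Z E := by
    refine aux_sq fun x hx => ?_
    exact ⟨⟨x, Subalgebra.mem_center_iff.2 hx⟩, rfl⟩
  have h2 := Module.finrank_mul_finrank ℚ Z E
  have h3 := Module.finrank_mul_finrank ℚ Z L
  have hZ : Module.finrank ℚ Z = n := hn
  have hn0 : 0 < n := hZ ▸ Module.finrank_pos
  rw [hZ, hdim] at h2
  rw [hZ] at h3
  have h4 := Nat.eq_of_mul_eq_mul_left hn0 h2
  rw [h4] at h1
  have h5 : Module.finrank Z L ≤ m := by
    exact (Nat.pow_le_pow_iff_left two_ne_zero).1 h1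
  let x : L := ⟨a, Algebra.self_mem_adjoin_singleton Z a⟩
  let g : L →ₐ[ℤ] E := (L.val.toRingHom).toIntAlgHom
  have hx : IsIntegral ℤ x := by
    rw [← isIntegral_algHom_iff g Subtype.val_injective]
    exact ha
  have : FiniteDimensional ℚ L := Module.Finite.trans Z _
  refine ⟨minpoly ℤ x, minpoly.monic hx, ?_, ?_⟩
  · have h6 := minpoly.isIntegrallyClosed_eq_field_fractions' ℚ hx
    have h7 := minpoly.natDegree_le (A := ℚ) x
    rw [h6, (minpoly.monic hx).natDegree_map, ← h3] at h7
    exact h7.trans (Nat.mul_le_mul_left _ h5)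
  · have := congrArg g (minpoly.aeval ℤ x)
    rw [← Polynomial.aeval_algHom_apply, map_zero] at this
    exact this

lemma aux_deg {D R : Type*} [Field D] [Finite D] (l : ℕ) (hl : l.Prime) [Algebra (ZMod l) D]
    [Ring R] (φ : D →+* R) (hφ : Function.Injective φ) (N : ℕ)
    (H : ∀ r : R, ∃ P : Polynomial ℤ, P.Monic ∧ P.natDegree ≤ N ∧ Polynomial.aeval r P = 0) :
    Module.finrank (ZMod l) D ≤ N := by
  have : Fact l.Prime := ⟨hl⟩
  have : FiniteDimensional (ZMod l) D := Module.Finite.of_finite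
  obtain ⟨α, hα⟩ := Field.exists_primitive_element (ZMod l) D
  rw [Field.primitive_element_iff_minpoly_natDegree_eq] at hα
  obtain ⟨P, hP, hPN, h⟩ := H (φ α)
  have h1 : Polynomial.aeval α P = 0 := by
    apply hφ
    have := Polynomial.aeval_algHom_apply φ.toIntAlgHom α P
    rw [map_zero, ← h]
    exact this.symm
  rw [← hα]
  refine le_trans ?_ (hPN.trans' (Polynomial.natDegree_map_le (f := algebraMap ℤ (ZMod l))))
  refine Polynomial.natDegree_le_of_dvd (minpoly.dvd _ _ ?_) (hP.map _).ne_zero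
  rw [Polynomial.aeval_map_algebraMap, h1]

theorem stmt0 {E : Type*} [DivisionRing E] [Algebra ℚ E] [FiniteDimensional ℚ E]
    (n m : ℕ) (hn : Module.finrank ℚ (Subalgebra.center ℚ E) = n)
    (hdim : Module.finrank ℚ E = n * m ^ 2)
    (O : Subring E) (hfg : Module.Finite ℤ O)
    (hspan : Submodule.span ℚ (O : Set E) = ⊤)
    (l : ℕ) (hl : l.Prime)
    (D : Type*) [DivisionRing D] [Algebra (ZMod l) D]
    (φ : D →+* O ⊗[ℤ] ZMod l) (hφ : Function.Injective φ) :
    Module.finrank (ZMod l) D ≤ n * m := by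
  have : NeZero l := ⟨hl.ne_zero⟩
  have : Finite (ZMod l ⊗[ℤ] O) := Module.finite_of_finite (ZMod l)
  have : Finite (O ⊗[ℤ] ZMod l) := Finite.of_equiv _ (TensorProduct.comm ℤ (ZMod l) O).toEquiv
  have : Finite D := Finite.of_injective φ hφ
  refine aux_deg l hl φ hφ (n * m) fun r => ?_
  have hs : ∃ a : O, (Algebra.TensorProduct.includeLeft : O →ₐ[ℤ] O ⊗[ℤ] ZMod l) a = r := by
    induction r using TensorProduct.induction_on with
    | zero => exact ⟨0, map_zero _⟩
    | tmul x y =>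
      obtain ⟨k, rfl⟩ := ZMod.intCast_surjective y
      refine ⟨k • x, ?_⟩
      rw [Algebra.TensorProduct.includeLeft_apply, TensorProduct.smul_tmul, zsmul_one]
    | add x y hx hy =>
      obtain ⟨a, rfl⟩ := hx
      obtain ⟨b, rfl⟩ := hy
      exact ⟨a + b, map_add _ _ _⟩
  obtain ⟨a, rfl⟩ := hs
  have hint : IsIntegral ℤ a := Algebra.IsIntegral.isIntegral a
  let g : O →ₐ[ℤ] E := O.subtype.toIntAlgHom
  obtain ⟨P, hP, hd, h⟩ := aux_field n m hn hdim (g a) (hint.map g)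
  refine ⟨P, hP, hd, ?_⟩
  rw [Polynomial.aeval_algHom_apply] at h ⊢
  have h0 : Polynomial.aeval a P = 0 := Subtype.val_injective h
  rw [h0, map_zero]
end

section
/- Let E be a division ring which is a finite-dimensional ℚ-algebra, let F be a maximal subfield of E, and set m = dim_F E. Let d ≥ 1 and let n be a positive integer coprime to m·d. If the quotient of the group GL_d(E) by its center contains an element of order n, then GL_d(E) itself contains an element of order n. -/
open Module TensorProduct

/-- Density for subalgebras of `End K E` that contain the left multiplications. -/
theorem aux_density {K E : Type*} [Field K] [DivisionRing E] [Algebra K E] [FiniteDimensional K E]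
    (A : Subalgebra K (Module.End K E)) (hA : ∀ e : E, LinearMap.mulLeft K e ∈ A)
    (f : Module.End K E)
    (hf : ∀ c : E, (∀ a ∈ A, ∀ x, a (x * c) = a x * c) → ∀ x, f (x * c) = f x * c) :
    f ∈ A := by
  have hsmul : ∀ (a : A) (x : E), a • x = (a : Module.End K E) x := fun a x => rfl
  have : IsSimpleModule A E := by
    rw [isSimpleModule_iff_toSpanSingleton_surjective]
    refine ⟨inferInstance, fun x hx y => ⟨⟨_, hA (y * x⁻¹)⟩, ?_⟩⟩
    simp [hsmul, hx]
  have key : ∀ (g : Module.End A E) (x : E), g x = x * g 1 := by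
    intro g x
    have := g.map_smul ⟨_, hA x⟩ 1
    simpa [hsmul] using this
  let f' : Module.End (Module.End A E) E :=
    { toFun := f
      map_add' := map_add f
      map_smul' := by
        intro g x
        simp only [Module.End.smul_def, RingHom.id_apply]
        rw [key g x, key g (f x)]
        apply hf
        intro a ha y
        rw [← key g y, ← key g (a y)]
        exact (g.map_smul ⟨a, ha⟩ y).symm }
  classical
  let b := Module.finBasis K E
  obtain ⟨r, hr⟩ := jacobson_density (R := A) (M := E) f' (Finset.univ.image b)
  have : f = r := by
    apply b.ext
    intro i
    exact hr (b i) (Finset.mem_image_of_mem _ (Finset.mem_univ i))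
  rw [this]
  exact r.2

theorem aux_inj {K E : Type*} [Field K] [DivisionRing E] [Algebra K E] [FiniteDimensional K E]
    [Algebra.IsCentral K E] : Function.Injective (AlgHom.mulLeftRight K E) := by
  have hs : Function.Surjective (AlgHom.mulLeftRight K E) := by
    rw [← AlgHom.range_eq_top, eq_top_iff]
    intro f _
    apply aux_density
    · intro e
      refine ⟨e ⊗ₜ 1, ?_⟩
      ext x
      simp [AlgHom.mulLeftRight_apply]
    · intro c hc x
      have hc' : c ∈ Subalgebra.center K E := by
        rw [Subalgebra.mem_center_iff]
        intro y
        have := hc _ ⟨1 ⊗ₜ MulOpposite.op y, rfl⟩ 1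
        simpa [AlgHom.mulLeftRight_apply] using this.symm
      obtain ⟨k, rfl⟩ := Algebra.IsCentral.mem_center_iff K |>.1 hc'
      rw [← Algebra.commutes, ← Algebra.commutes, ← Algebra.smul_def, ← Algebra.smul_def, map_smul]
  have hfr : finrank K (E ⊗[K] Eᵐᵒᵖ) = finrank K (Module.End K E) := by
    rw [Module.finrank_tensorProduct, Module.finrank_linearMap,
      (MulOpposite.opLinearEquiv K : E ≃ₗ[K] Eᵐᵒᵖ).finrank_eq]
  exact (LinearMap.injective_iff_surjective_of_finrank_eq_finrank hfr
    (f := (AlgHom.mulLeftRight K E).toLinearMap)).2 hs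

theorem aux_dim {K E F : Type*} [Field K] [DivisionRing E] [Algebra K E] [FiniteDimensional K E]
    [Algebra.IsCentral K E] [Field F] [Algebra K F] (φ : F →ₐ[K] E)
    (hφ : ∀ c : E, (∀ t, c * φ t = φ t * c) → ∃ t, φ t = c) :
    finrank K E = finrank K F * finrank K F := by
  let ψ : F →ₐ[K] Eᵐᵒᵖ :=
    { toFun := fun t => MulOpposite.op (φ t)
      map_one' := by simp
      map_mul' := fun a b => by rw [mul_comm, map_mul, MulOpposite.op_mul]
      map_zero' := by simp
      map_add' := by simp
      commutes' := fun k => by simp [MulOpposite.algebraMap_apply] }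
  let : Module F E := Module.compHom E ψ.toRingHom
  have hsm : ∀ (t : F) (x : E), t • x = x * φ t := fun t x => rfl
  have : IsScalarTower K F E := ⟨fun k t x => by simp [hsm]⟩
  have : FiniteDimensional K F :=
    FiniteDimensional.of_injective φ.toLinearMap φ.toRingHom.injective
  have : FiniteDimensional F E := FiniteDimensional.right K F E
  let ρ : E ⊗[K] F →ₐ[K] Module.End K E :=
    (AlgHom.mulLeftRight K E).comp (Algebra.TensorProduct.map (AlgHom.id K E) ψ)
  have hρ : ∀ e t x, ρ (e ⊗ₜ t) x = e * x * φ t := by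
    intro e t x
    simp [ρ, ψ, AlgHom.mulLeftRight_apply]
    exact Or.inl rfl
  have hψ : Function.Injective ψ := ψ.toRingHom.injective
  have hinj : Function.Injective ρ := by
    refine aux_inj.comp ?_
    exact Module.Flat.lTensor_preserves_injective_linearMap (M := E) ψ.toLinearMap hψ
  let R : (E →ₗ[F] E) →ₗ[K] Module.End K E :=
    { toFun := fun g => g.restrictScalars K
      map_add' := fun _ _ => rfl
      map_smul' := fun _ _ => rfl }
  have hR : Function.Injective R := fun a b h => by
    ext x
    exact congrArg (fun g : Module.End K E => g x) h
  have hrange : LinearMap.range R = LinearMap.range ρ.toLinearMap := by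
    apply le_antisymm
    · rintro _ ⟨g, rfl⟩
      change R g ∈ ρ.range
      apply aux_density
      · intro e
        refine ⟨e ⊗ₜ 1, ?_⟩
        ext x
        change ρ _ x = _
        simp [hρ]
      · intro c hc x
        obtain ⟨t, rfl⟩ := hφ c (fun t => by
          have := hc _ ⟨1 ⊗ₜ t, rfl⟩ 1
          change ρ _ _ = ρ _ _ * _ at this
          simpa [hρ] using this)
        exact g.map_smul t x
    · rintro _ ⟨u, rfl⟩
      induction u using TensorProduct.induction_on with
      | zero => simp
      | add a b ha hb => rw [map_add]; exact add_mem ha hb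
      | tmul e t =>
        refine ⟨{ toFun := ρ (e ⊗ₜ t), map_add' := map_add _, map_smul' := ?_ }, ?_⟩
        · intro s x
          simp only [hρ, hsm, RingHom.id_apply, mul_assoc]
          rw [← map_mul, ← map_mul, mul_comm]
        · rfl
  have h1 : finrank K (E →ₗ[F] E) = finrank K (E ⊗[K] F) := by
    rw [← LinearMap.finrank_range_of_inj hR, hrange, LinearMap.finrank_range_of_inj]
    exact hinj
  rw [Module.finrank_linearMap, Module.finrank_tensorProduct, mul_comm] at h1
  have hpos : 0 < finrank K E := Module.finrank_pos
  have h2 := Nat.eq_of_mul_eq_mul_left hpos h1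
  rw [← Module.finrank_mul_finrank K F E, h2]

theorem aux_m {E : Type*} [DivisionRing E] [Algebra ℚ E] [FiniteDimensional ℚ E]
    (F : Subalgebra ℚ E)
    (hcomm : ∀ x ∈ F, ∀ y ∈ F, x * y = y * x)
    (hmax : ∀ F' : Subalgebra ℚ E, (∀ x ∈ F', ∀ y ∈ F', x * y = y * x) → F ≤ F' → F' = F)
    (m : ℕ) (hm : Module.finrank ℚ E = m * Module.finrank ℚ F) :
    finrank (Subring.center E) E = m * m ∧ FiniteDimensional (Subring.center E) E := by
  have hcent : ∀ c : E, (∀ t ∈ F, c * t = t * c) → c ∈ F := by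
    intro c hc
    have := hmax (Algebra.adjoin ℚ (insert c (F : Set E))) ?_ ?_
    · rw [← this]; exact Algebra.subset_adjoin (Set.mem_insert _ _)
    · have h0 : ∀ a ∈ insert c (F : Set E), ∀ b ∈ insert c (F : Set E), a * b = b * a := by
        rintro a (rfl | ha) b (rfl | hb)
        · rfl
        · exact hc _ hb
        · exact (hc _ ha).symm
        · exact hcomm _ ha _ hb
      let := Algebra.adjoinCommRingOfComm ℚ h0
      intro x hx y hy
      exact congrArg Subtype.val (mul_comm (⟨x, hx⟩ : Algebra.adjoin ℚ (insert c (F : Set E))) ⟨y, hy⟩)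
    · intro x hx
      exact Algebra.subset_adjoin (Set.mem_insert_of_mem _ hx)
  have : CharZero E := algebraRat.charZero E
  have : CharZero (Subring.center E) := ⟨fun a b h => by
    have := congrArg (Subtype.val) h
    simpa using this⟩
  have : IsScalarTower ℚ (Subring.center E) E := inferInstance
  have : FiniteDimensional (Subring.center E) E := FiniteDimensional.right ℚ _ E
  have : Algebra.IsCentral (Subring.center E) E := ⟨by
    intro x hx
    rw [Subalgebra.mem_center_iff] at hx
    exact ⟨⟨x, Subring.mem_center_iff.2 hx⟩, rfl⟩⟩
  let ι : Subring.center E →+* F :=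
    { toFun := fun z => ⟨z, hcent _ fun t _ => (Subring.mem_center_iff.1 z.2 t).symm⟩
      map_one' := rfl
      map_mul' := fun _ _ => rfl
      map_zero' := rfl
      map_add' := fun _ _ => rfl }
  let : Algebra (Subring.center E) F :=
    ι.toAlgebra' fun z x => Subtype.ext (hcomm _ (ι z).2 _ x.2)
  have : IsScalarTower ℚ (Subring.center E) F := by
    refine ⟨fun q z x => ?_⟩
    apply Subtype.ext
    have := smul_assoc q z (x : E)
    exact this
  have h2 : finrank ℚ (Subring.center E) * finrank (Subring.center E) F = finrank ℚ F :=
    Module.finrank_mul_finrank ℚ (Subring.center E) F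
  let : Field F := 
    { (inferInstance : Ring F), (inferInstance : Nontrivial F) with
      mul_comm := fun a b => Subtype.ext (hcomm _ a.2 _ b.2)
      inv := fun a => ⟨(a : E)⁻¹, hcent _ fun t ht => by
        have : Commute (a : E) t := hcomm _ a.2 _ ht
        exact this.inv_left₀⟩
      mul_inv_cancel := fun a ha => Subtype.ext (mul_inv_cancel₀ (fun h => ha (Subtype.ext h)))
      inv_zero := Subtype.ext inv_zero
      nnqsmul := _
      nnqsmul_def := fun _ _ => rfl
      qsmul := _
      qsmul_def := fun _ _ => rfl }
  let φ : F →ₐ[Subring.center E] E :=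
    { toFun := fun t => t
      map_one' := rfl
      map_mul' := fun _ _ => rfl
      map_zero' := rfl
      map_add' := fun _ _ => rfl
      commutes' := fun _ => rfl }
  have hd := aux_dim φ (fun c hc => ⟨⟨c, hcent c fun t ht => hc ⟨t, ht⟩⟩, rfl⟩)
  have h1 := Module.finrank_mul_finrank ℚ (Subring.center E) E
  have hE : 0 < finrank ℚ E := Module.finrank_pos
  refine ⟨?_, inferInstance⟩
  have hF : 0 < finrank ℚ F := Nat.pos_of_ne_zero fun h => by rw [h] at hm; omega
  have : m = finrank (Subring.center E) F := by
    refine Nat.eq_of_mul_eq_mul_right hF ?_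
    rw [← hm, ← h1, hd]
    conv_rhs => rw [← h2]
    ring
  rw [this, hd]

theorem aux_unit {A : Type*} [Ring A] [Algebra ℚ A] [FiniteDimensional ℚ A] (u : Aˣ)
    (hu : u ∈ Subgroup.center Aˣ) (a : A) : a * u = u * a := by
  obtain ⟨t, ht⟩ := (Module.End.finite_spectrum (Algebra.lmul ℚ A a)).exists_notMem
  rw [spectrum.notMem_iff, ← AlgHom.commutes (Algebra.lmul ℚ A), ← map_sub] at ht
  have hbij := (Module.End.isUnit_iff _).1 ht
  have h1 : IsUnit (algebraMap ℚ A t - a) := by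
    obtain ⟨b, hb⟩ := hbij.2 1
    have hb' : (algebraMap ℚ A t - a) * b = 1 := hb
    refine ⟨⟨_, b, hb', hbij.1 ?_⟩, rfl⟩
    change (algebraMap ℚ A t - a) * (b * (algebraMap ℚ A t - a)) = (algebraMap ℚ A t - a) * 1
    rw [← mul_assoc, hb', one_mul, mul_one]
  obtain ⟨v, hv⟩ := h1
  have := congrArg Units.val (Subgroup.mem_center_iff.1 hu v)
  simp only [Units.val_mul, hv, sub_mul, mul_sub, Algebra.commutes] at this
  exact sub_right_injective this

theorem stmt1 {E : Type*} [DivisionRing E] [Algebra ℚ E] [FiniteDimensional ℚ E]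
    (F : Subalgebra ℚ E)
    (hcomm : ∀ x ∈ F, ∀ y ∈ F, x * y = y * x)
    (hmax : ∀ F' : Subalgebra ℚ E, (∀ x ∈ F', ∀ y ∈ F', x * y = y * x) → F ≤ F' → F' = F)
    (m d n : ℕ) (hm : Module.finrank ℚ E = m * Module.finrank ℚ F)
    (hd : 1 ≤ d) (hn : 0 < n) (hcop : Nat.Coprime n (m * d))
    (h : ∃ x : (Matrix (Fin d) (Fin d) E)ˣ ⧸ Subgroup.center (Matrix (Fin d) (Fin d) E)ˣ,
      orderOf x = n) :
    ∃ y : (Matrix (Fin d) (Fin d) E)ˣ, orderOf y = n := by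
  obtain ⟨hK, hfin⟩ := aux_m F hcomm hmax m hm
  obtain ⟨x, hx⟩ := h
  obtain ⟨g, rfl⟩ := QuotientGroup.mk_surjective x
  have : Nonempty (Fin d) := ⟨⟨0, hd⟩⟩
  have : Algebra.IsCentral (Subring.center E) E := ⟨by
    intro x hx
    rw [Subalgebra.mem_center_iff] at hx
    exact ⟨⟨x, Subring.mem_center_iff.2 hx⟩, rfl⟩⟩
  have hgn : g ^ n ∈ Subgroup.center (Matrix (Fin d) (Fin d) E)ˣ := by
    rw [← QuotientGroup.eq_one_iff, QuotientGroup.mk_pow, ← hx, pow_orderOf_eq_one]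
  have hc : ((g ^ n : (Matrix (Fin d) (Fin d) E)ˣ) : Matrix (Fin d) (Fin d) E) ∈
      Subalgebra.center (Subring.center E) (Matrix (Fin d) (Fin d) E) := by
    rw [Subalgebra.mem_center_iff]
    exact aux_unit _ hgn
  obtain ⟨z, hz⟩ := (Algebra.IsCentral.mem_center_iff (Subring.center E)).1 hc
  have hnorm : (Algebra.norm (Subring.center E) (g : Matrix (Fin d) (Fin d) E)) ^ n
      = z ^ (d * d * (m * m)) := by
    rw [← map_pow, ← Units.val_pow_eq_pow_val, hz, Algebra.norm_algebraMap, Module.finrank_matrix,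
      hK, Fintype.card_fin]
  have hz0 : z ≠ 0 := by
    rintro rfl
    rw [map_zero] at hz
    exact (g ^ n).ne_zero hz
  have hcop' : Nat.Coprime n (d * d * (m * m)) := by
    have h1 := Nat.Coprime.coprime_mul_right_right hcop
    have h2 := Nat.Coprime.coprime_mul_left_right hcop
    exact (h2.mul_right h2).mul_right (h1.mul_right h1)
  obtain ⟨w, hw⟩ : ∃ w : Subring.center E, w ^ n = z := by
    have hb := Nat.gcd_eq_gcd_ab n (d * d * (m * m))
    rw [Nat.Coprime.gcd_eq_one hcop'] at hb
    set N := d * d * (m * m)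
    set a := Nat.gcdA n N
    set b := Nat.gcdB n N
    set ν := Algebra.norm (Subring.center E) (g : Matrix (Fin d) (Fin d) E)
    refine ⟨z ^ a * ν ^ b, ?_⟩
    calc (z ^ a * ν ^ b) ^ n = z ^ ((n : ℤ) * a) * (ν ^ n) ^ b := by
          rw [mul_pow, ← zpow_natCast, ← zpow_natCast, ← zpow_natCast, ← zpow_mul, ← zpow_mul,
            ← zpow_mul, mul_comm a, mul_comm b]
      _ = z ^ ((n : ℤ) * a + N * b) := by
          rw [hnorm, zpow_add₀ hz0, zpow_mul z (N : ℤ), zpow_natCast]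
      _ = z := by rw [← hb]; simp
  have hw0 : w ≠ 0 := by
    rintro rfl
    rw [zero_pow hn.ne'] at hw
    exact hz0 hw.symm
  let W : (Matrix (Fin d) (Fin d) E)ˣ :=
    Units.map (algebraMap (Subring.center E) (Matrix (Fin d) (Fin d) E)).toMonoidHom
      (Units.mk0 w hw0)
  have hW : W ∈ Subgroup.center (Matrix (Fin d) (Fin d) E)ˣ := by
    rw [Subgroup.mem_center_iff]
    intro v
    ext1
    exact (Algebra.commutes w (v : Matrix (Fin d) (Fin d) E)).symm
  have hWn : W ^ n = g ^ n := by
    ext1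
    rw [hz, ← hw, map_pow]
    rfl
  refine ⟨g * W⁻¹, ?_⟩
  apply Nat.dvd_antisymm
  · apply orderOf_dvd_of_pow_eq_one
    have : Commute g W⁻¹ := Subgroup.mem_center_iff.1 (inv_mem hW) g
    rw [this.mul_pow, inv_pow, hWn, mul_inv_cancel]
  · have := orderOf_map_dvd (QuotientGroup.mk' (Subgroup.center (Matrix (Fin d) (Fin d) E)ˣ))
      (g * W⁻¹)
    rw [map_mul, (QuotientGroup.eq_one_iff (N := Subgroup.center _) W⁻¹).2 (inv_mem hW) |> fun h => (h : QuotientGroup.mk' _ W⁻¹ = 1), mul_one] at this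
    rw [← hx]
    exact this
end

section
/- Let g be an odd positive integer, and let l and p = 2g+1 be distinct primes such that the multiplicative order of l modulo p equals g. Let V be a 2g-dimensional F_l-vector space equipped with a nondegenerate alternating bilinear form ω, and let σ be an F_l-linear automorphism of V of order p satisfying ω(σu, σv) = ω(u, v) for all u, v ∈ V. Then there exist σ-invariant subspaces U and W of V, each of dimension g over F_l and each irreducible as an F_l⟨σ⟩-module, such that V = U ⊕ W and U is not isomorphic to W as an F_l⟨σ⟩-module. -/
open Polynomial

lemma alt_even {K : Type*} [Field K] (n : ℕ) : ∀ (V : Type _) [AddCommGroup V] [Module K V]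
    [Module.Finite K V] (ω : V →ₗ[K] V →ₗ[K] K) (_ : ∀ v, ω v v = 0)
    (_ : ∀ v, (∀ w, ω v w = 0) → v = 0) (_ : Module.finrank K V = n), Even n := by
  induction n using Nat.strong_induction_on with
  | _ n ih =>
  intro V _ _ _ ω halt hnd hn
  rcases Nat.eq_zero_or_pos n with h0 | hpos
  · simp [h0]
  have : Nontrivial V := Module.nontrivial_of_finrank_pos (R := K) (by omega)
  obtain ⟨v, hv⟩ := exists_ne (0 : V)
  have : ∃ w, ω v w ≠ 0 := by
    by_contra! h
    exact hv (hnd v h)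
  obtain ⟨w, hw⟩ := this
  have hsk : ∀ x y, ω x y = - ω y x := fun x y => (LinearMap.IsAlt.neg (B := ω) halt y x).symm
  have hw' : ω w v ≠ 0 := by rw [hsk]; simpa using hw
  let φ : V →ₗ[K] K × K := (ω v).prod (ω w)
  have hφ : ∀ x, φ x = (ω v x, ω w x) := fun x => rfl
  have hsurj : LinearMap.range φ = ⊤ := by
    rw [LinearMap.range_eq_top]
    rintro ⟨a, b⟩
    refine ⟨(a / ω v w) • w + (b / ω w v) • v, ?_⟩
    simp [hφ, halt, hw, hw']
  have hrk := LinearMap.finrank_range_add_finrank_ker φ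
  rw [hsurj, finrank_top, Module.finrank_prod, Module.finrank_self, hn] at hrk
  have hev := ih (Module.finrank K (LinearMap.ker φ)) (by omega) (LinearMap.ker φ)
    (ω.domRestrict₁₂ _ _) (fun x => halt x) (by
      intro x hx
      have hx' : ω v x = 0 ∧ ω w x = 0 := by
        have := x.2
        rw [LinearMap.mem_ker, hφ] at this
        simpa using this
      apply Subtype.ext
      apply hnd
      intro y
      have := hx ⟨y - (ω v y / ω v w) • w - (ω w y / ω w v) • v, by
        simp [LinearMap.mem_ker, hφ, halt, hw, hw']⟩
      simp only [LinearMap.domRestrict₁₂_apply, map_sub, map_smul, smul_eq_mul] at this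
      rw [hsk x w, hsk x v, hx'.1, hx'.2] at this
      simpa using this) rfl
  rw [← hrk]
  exact Even.add (by decide) hev

lemma sub_even {K V : Type*} [Field K] [AddCommGroup V] [Module K V]
    [Module.Finite K V] (ω : V →ₗ[K] V →ₗ[K] K) (halt : ∀ v, ω v v = 0)
    (S : Submodule K V) (hS : ∀ v ∈ S, (∀ w ∈ S, ω v w = 0) → v = 0) :
    Even (Module.finrank K S) := by
  refine alt_even _ S (ω.domRestrict₁₂ S S) (fun x => halt x) ?_ rfl
  intro v hv
  exact Subtype.ext (hS v v.2 fun w hw => hv ⟨w, hw⟩)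

lemma g_dvd {g l p : ℕ} [Fact l.Prime] [Fact p.Prime] (hord : orderOf (l : ZMod p) = g)
    {V : Type*} [AddCommGroup V] [Module (ZMod l) V] [Module.Finite (ZMod l) V]
    (σ : V ≃ₗ[ZMod l] V) (hσ : ∀ v, (σ ^ p) v = v) (S : Submodule (ZMod l) V)
    (hS : ∀ v ∈ S, σ v ∈ S) (hfix : ∀ v ∈ S, σ v = v → v = 0) :
    g ∣ Module.finrank (ZMod l) S := by
  classical
  have : Finite V := Module.finite_of_finite (ZMod l)
  have : Fintype S := Fintype.ofFinite _
  let f : Function.End S := fun x => ⟨σ x, hS x x.2⟩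
  have hf : ∀ (n : ℕ) (x : S), (((f ^ n) x : S) : V) = (σ ^ n) x := by
    intro n
    induction n with
    | zero => intro x; rfl
    | succ n ih => intro x; rw [pow_succ, pow_succ]; exact ih (f x)
  have h1 := Equiv.Perm.card_fixedPoints_modEq (f := f) (p := p) (n := 1) (by
    funext x
    apply Subtype.ext
    rw [hf, pow_one, hσ]; rfl)
  have h2 : Fintype.card f.fixedPoints = 1 := by
    rw [Fintype.card_eq_one_iff]
    refine ⟨⟨0, Subtype.ext (by simp [f])⟩, ?_⟩
    rintro ⟨x, hx⟩
    apply Subtype.ext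
    apply Subtype.ext
    exact hfix x x.2 (congrArg Subtype.val hx)
  rw [h2, ← Nat.card_eq_fintype_card, Module.natCard_eq_pow_finrank (K := ZMod l), Nat.card_zmod] at h1
  rw [← hord]
  apply orderOf_dvd_of_pow_eq_one
  have := (ZMod.natCast_eq_natCast_iff _ _ _).2 h1
  simpa using this

lemma no_small {g l p : ℕ} (hg : Odd g) [Fact l.Prime] [Fact p.Prime] (hp : p = 2 * g + 1)
    (hord : orderOf (l : ZMod p) = g)
    {V : Type*} [AddCommGroup V] [Module (ZMod l) V] [Module.Finite (ZMod l) V]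
    (ω : V →ₗ[ZMod l] V →ₗ[ZMod l] ZMod l)
    (halt : ∀ v : V, ω v v = 0)
    (hnondeg : ∀ v : V, (∀ w : V, ω v w = 0) → v = 0)
    (σ : V ≃ₗ[ZMod l] V) (hσ : orderOf σ = p)
    (hω : ∀ u v : V, ω (σ u) (σ v) = ω u v)
    (hfix : ∀ v, σ v = v → v = 0)
    (q : (ZMod l)[X]) (hq0 : q ≠ 0) (hq : q.natDegree = g)
    (hqσ : aeval (σ : V →ₗ[ZMod l] V) q = 0) : False := by
  have hσp : ∀ v, (σ ^ p) v = v := fun v => by rw [← hσ, pow_orderOf_eq_one]; rfl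
  have hsk : ∀ x y, ω x y = - ω y x := fun x y => (LinearMap.IsAlt.neg (B := ω) halt y x).symm
  have hgpos : 0 < g := hg.pos
  have key : ∀ v, ω v (σ v) = 0 := by
    intro v
    by_cases hv : v = 0
    · simp [hv]
    let φ : (ZMod l)[X] →ₗ[ZMod l] V :=
      (LinearMap.applyₗ v).comp (aeval (σ : V →ₗ[ZMod l] V)).toLinearMap
    have hφ : ∀ P, φ P = aeval (σ : V →ₗ[ZMod l] V) P v := fun P => rfl
    have hφX : ∀ P, φ (X * P) = σ (φ P) := by
      intro P
      rw [hφ, hφ, map_mul, aeval_X]; rfl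
    let S := LinearMap.range φ
    have hvS : v ∈ S := ⟨1, by simp [hφ]⟩
    have hS : ∀ x ∈ S, σ x ∈ S := by
      rintro _ ⟨P, rfl⟩
      exact ⟨X * P, hφX P⟩
    have hSpow : ∀ n : ℕ, ∀ x ∈ S, (σ ^ n) x ∈ S := by
      intro n
      induction n with
      | zero => intro x hx; exact hx
      | succ n ih => intro x hx; rw [pow_succ]; exact ih _ (hS x hx)
    have hSle : Module.finrank (ZMod l) S ≤ g := by
      have hle : S ≤ (degreeLT (ZMod l) g).map φ := by
        rintro _ ⟨P, rfl⟩
        refine ⟨P % q, ?_, ?_⟩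
        · rw [SetLike.mem_coe, mem_degreeLT, ← hq, ← degree_eq_natDegree hq0]
          exact EuclideanDomain.mod_lt P hq0
        · conv_rhs => rw [← EuclideanDomain.mod_add_div P q]
          rw [hφ, hφ, map_add, map_mul, hqσ]; simp
      have : Module.Finite (ZMod l) (degreeLT (ZMod l) g) :=
        Module.Finite.equiv (degreeLTEquiv (ZMod l) g).symm
      calc _ ≤ _ := Submodule.finrank_mono hle
        _ ≤ _ := Submodule.finrank_map_le _ _
        _ = g := by rw [(degreeLTEquiv (ZMod l) g).finrank_eq]; simp
    have hSd := g_dvd hord σ hσp S hS (fun v _ => hfix v)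
    have hS0 : Module.finrank (ZMod l) S ≠ 0 := by
      intro h
      rw [Submodule.finrank_eq_zero] at h
      rw [h] at hvS
      exact hv (by simpa using hvS)
    have hSg : Module.finrank (ZMod l) S = g :=
      le_antisymm hSle (Nat.le_of_dvd (Nat.pos_of_ne_zero hS0) hSd)
    let R : Submodule (ZMod l) V := 
      { carrier := {x | x ∈ S ∧ ∀ y ∈ S, ω x y = 0}
        add_mem' := by
          rintro a b ⟨ha, ha'⟩ ⟨hb, hb'⟩
          exact ⟨S.add_mem ha hb, fun y hy => by simp [ha' y hy, hb' y hy]⟩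
        zero_mem' := ⟨S.zero_mem, fun y hy => by simp⟩
        smul_mem' := by
          rintro c a ⟨ha, ha'⟩
          exact ⟨S.smul_mem c ha, fun y hy => by simp [ha' y hy]⟩ }
    have hRS : R ≤ S := fun x hx => hx.1
    have hR : ∀ x ∈ R, σ x ∈ R := by
      rintro x ⟨hx, hx'⟩
      refine ⟨hS x hx, fun y hy => ?_⟩
      have h1 : y = σ ((σ ^ (p - 1)) y) := by
        have h2 : σ ((σ ^ (p - 1)) y) = (σ ^ (p - 1 + 1)) y := by rw [pow_succ']; rfl
        rw [h2, show p - 1 + 1 = p by omega, hσp]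
      rw [h1, hω]
      exact hx' _ (hSpow _ y hy)
    have hRd := g_dvd hord σ hσp R hR (fun v _ => hfix v)
    have hR0 : Module.finrank (ZMod l) R ≠ 0 := by
      intro h
      rw [Submodule.finrank_eq_zero] at h
      have := sub_even ω halt S (by
        intro x hx hx'
        have : x ∈ R := ⟨hx, hx'⟩
        rw [h] at this
        simpa using this)
      rw [hSg] at this
      exact (Nat.not_even_iff_odd.2 hg) this
    have hReq : R = S := Submodule.eq_of_le_of_finrank_le hRS (by
      rw [hSg]; exact Nat.le_of_dvd (Nat.pos_of_ne_zero hR0) hRd)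
    have : v ∈ R := hReq ▸ hvS
    exact this.2 _ (hS v hvS)
  have h2 : σ ^ 2 = 1 := by
    ext v
    change (σ ^ 2) v = v
    have h3 : (σ ^ 2) v = σ (σ v) := by rw [pow_two]; rfl
    rw [h3, ← sub_eq_zero]
    apply hnondeg
    intro u
    have hpol := key (u + σ v)
    simp only [map_add, LinearMap.add_apply, key, zero_add, add_zero] at hpol
    rw [hω, hsk u (σ (σ v))] at hpol
    simp only [map_sub, LinearMap.sub_apply]
    linear_combination -hpol
  have := orderOf_dvd_of_pow_eq_one h2
  rw [hσ] at this
  have := Nat.le_of_dvd (by norm_num) this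
  omega

lemma no_fix {g l p : ℕ} (hg : Odd g) [Fact l.Prime] [Fact p.Prime] (hp : p = 2 * g + 1)
    (hlp : l ≠ p)
    (hord : orderOf (l : ZMod p) = g)
    {V : Type*} [AddCommGroup V] [Module (ZMod l) V] [Module.Finite (ZMod l) V]
    (hdim : Module.finrank (ZMod l) V = 2 * g)
    (ω : V →ₗ[ZMod l] V →ₗ[ZMod l] ZMod l)
    (halt : ∀ v : V, ω v v = 0)
    (hnondeg : ∀ v : V, (∀ w : V, ω v w = 0) → v = 0)
    (σ : V ≃ₗ[ZMod l] V) (hσ : orderOf σ = p)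
    (hω : ∀ u v : V, ω (σ u) (σ v) = ω u v) (hp0 : (p : ZMod l) ≠ 0) :
    ∀ v, σ v = v → v = 0 := by
  have hσp : ∀ v, (σ ^ p) v = v := fun v => by rw [← hσ, pow_orderOf_eq_one]; rfl
  have hgpos : 0 < g := hg.pos
  let τ : V →ₗ[ZMod l] V := (σ : V →ₗ[ZMod l] V) - LinearMap.id
  have hτ : ∀ v, τ v = σ v - v := fun v => rfl
  let S := LinearMap.range τ
  have hS : ∀ x ∈ S, σ x ∈ S := by
    rintro _ ⟨v, rfl⟩
    exact ⟨σ v, by simp [hτ]⟩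
  have hfixS : ∀ x ∈ S, σ x = x → x = 0 := by
    rintro x ⟨v, hv⟩ hx
    have hv' : σ v = v + x := by rw [← hv, hτ]; abel
    have hn : ∀ n : ℕ, (σ ^ n) v = v + (n : ZMod l) • x := by
      intro n
      induction n with
      | zero => simp
      | succ n ih =>
        have : (σ ^ (n + 1)) v = σ ((σ ^ n) v) := by rw [pow_succ']; rfl
        rw [this, ih, map_add, map_smul, hx, hv']
        push_cast
        module
    have := hn p
    rw [hσp] at this
    have h0 : (p : ZMod l) • x = 0 := by simpa using this
    exact (smul_eq_zero.1 h0).resolve_left hp0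
  have hSd := g_dvd hord σ hσp S hS hfixS
  have hperp : ∀ x ∈ S, ∀ y, σ y = y → ω x y = 0 := by
    rintro _ ⟨v, rfl⟩ y hy
    rw [hτ, map_sub, LinearMap.sub_apply]
    nth_rewrite 1 [← hy]
    rw [hω, sub_self]
  have hrk := LinearMap.finrank_range_add_finrank_ker τ
  rw [hdim] at hrk
  have hdisj : Disjoint S (LinearMap.ker τ) := by
    rw [Submodule.disjoint_def]
    intro x hx hx'
    exact hfixS x hx (by rw [LinearMap.mem_ker, hτ, sub_eq_zero] at hx'; exact hx')
  have htop : S ⊔ LinearMap.ker τ = ⊤ := 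
    Submodule.eq_top_of_disjoint _ _ (by rw [hdim]; exact hrk.ge) hdisj
  have heven : Even (Module.finrank (ZMod l) S) := sub_even ω halt S (by
    intro x hx hx'
    apply hnondeg
    intro w
    obtain ⟨a, ha, b, hb, rfl⟩ := Submodule.mem_sup.1 (htop ▸ Submodule.mem_top : w ∈ S ⊔ LinearMap.ker τ)
    rw [map_add, hx' a ha, hperp x hx b (by rw [LinearMap.mem_ker, hτ, sub_eq_zero] at hb; exact hb), add_zero])
  have hS0 : Module.finrank (ZMod l) S ≠ 0 := by
    intro h
    rw [Submodule.finrank_eq_zero] at h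
    have : σ = 1 := by
      ext v
      have : τ v ∈ S := ⟨v, rfl⟩
      rw [h, Submodule.mem_bot, hτ, sub_eq_zero] at this
      exact this
    rw [this, orderOf_one] at hσ
    omega
  have hk : Module.finrank (ZMod l) (LinearMap.ker τ) = 0 := by
    obtain ⟨k, hk⟩ := hSd
    change Module.finrank (ZMod l) S + _ = _ at hrk
    rw [hk] at heven hS0 hrk
    have hke : Even k := (Nat.even_mul.1 heven).resolve_left (Nat.not_even_iff_odd.2 hg)
    obtain ⟨m, rfl⟩ := hke
    have : 1 ≤ m := by
      rcases Nat.eq_zero_or_pos m with h | h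
      · simp [h] at hS0
      · exact h
    nlinarith
  intro v hv
  rw [Submodule.finrank_eq_zero] at hk
  have : v ∈ LinearMap.ker τ := by rw [LinearMap.mem_ker, hτ, hv, sub_self]
  rw [hk] at this
  simpa using this

theorem stmt5 (g l p : ℕ) (hg : Odd g) (hgpos : 0 < g)
    (hl : l.Prime) (hp : p = 2 * g + 1) (hpprime : p.Prime) (hlp : l ≠ p)
    (hord : orderOf (l : ZMod p) = g)
    (V : Type*) [AddCommGroup V] [Module (ZMod l) V] [Module.Finite (ZMod l) V]
    (hdim : Module.finrank (ZMod l) V = 2 * g)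
    (ω : V →ₗ[ZMod l] V →ₗ[ZMod l] ZMod l)
    (halt : ∀ v : V, ω v v = 0)
    (hnondeg : ∀ v : V, (∀ w : V, ω v w = 0) → v = 0)
    (σ : V ≃ₗ[ZMod l] V) (hσ : orderOf σ = p)
    (hω : ∀ u v : V, ω (σ u) (σ v) = ω u v) :
    ∃ (U W : Submodule (ZMod l) V) (hU : ∀ v ∈ U, σ v ∈ U) (_ : ∀ v ∈ W, σ v ∈ W),
      Module.finrank (ZMod l) U = g ∧ Module.finrank (ZMod l) W = g ∧
      (U ≠ ⊥ ∧ ∀ U' : Submodule (ZMod l) V, U' ≤ U → (∀ v ∈ U', σ v ∈ U') →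
        U' = ⊥ ∨ U' = U) ∧
      (W ≠ ⊥ ∧ ∀ W' : Submodule (ZMod l) V, W' ≤ W → (∀ v ∈ W', σ v ∈ W') →
        W' = ⊥ ∨ W' = W) ∧
      IsCompl U W ∧
      ¬ ∃ e : U ≃ₗ[ZMod l] W, ∀ u : U,
        (e ⟨σ (u : V), hU (u : V) u.2⟩ : V) = σ ((e u : V)) := by
  haveI : Fact l.Prime := ⟨hl⟩
  haveI : Fact p.Prime := ⟨hpprime⟩
  have hcop : l.Coprime p := (Nat.coprime_primes hl hpprime).2 hlp
  have hp0 : (p : ZMod l) ≠ 0 := by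
    rw [Ne, ZMod.natCast_eq_zero_iff]
    intro h
    exact hlp ((Nat.prime_dvd_prime_iff_eq hl hpprime).1 h)
  haveI : NeZero (p : ZMod l) := ⟨hp0⟩
  have hσp : ∀ v, (σ ^ p) v = v := fun v => by rw [← hσ, pow_orderOf_eq_one]; rfl
  have hfix := no_fix hg hp hlp hord hdim ω halt hnondeg σ hσ hω hp0
  have hsmall := no_small hg hp hord ω halt hnondeg σ hσ hω hfix
  have hdvd := fun S hS => g_dvd hord σ hσp S hS (fun v _ => hfix v)
  have hdeg : (cyclotomic p (ZMod l)).natDegree = 2 * g := by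
    rw [natDegree_cyclotomic, Nat.totient_prime hpprime]; omega
  obtain ⟨f, hfirr, h, hfh⟩ := WfDvdMonoid.exists_irreducible_factor
    (a := cyclotomic p (ZMod l))
    (fun hu => by have := natDegree_eq_zero_of_isUnit hu; omega) (cyclotomic_ne_zero _ _)
  have hfd : f.natDegree = g := by
    rw [natDegree_of_dvd_cyclotomic_of_irreducible (p := l) (f := 1) (n := p) (by simp) hcop
      ⟨h, hfh⟩ hfirr, ← hord, ← orderOf_units]
    simp
  have hne : f * h ≠ 0 := hfh ▸ cyclotomic_ne_zero _ _
  have hf0 : f ≠ 0 := left_ne_zero_of_mul hne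
  have hh0 : h ≠ 0 := right_ne_zero_of_mul hne
  have hhd : h.natDegree = g := by
    rw [hfh, natDegree_mul hf0 hh0] at hdeg
    omega
  have hco : IsCoprime f h := Separable.isCoprime (hfh ▸ separable_cyclotomic p (ZMod l))
  set s : V →ₗ[ZMod l] V := (σ : V →ₗ[ZMod l] V) with hs
  have hspow : ∀ (n : ℕ) v, (s ^ n) v = (σ ^ n) v := by
    intro n
    induction n with
    | zero => intro v; rfl
    | succ n ih => intro v; rw [pow_succ, pow_succ]; exact ih (σ v)
  have hcyc : aeval s (f * h) = 0 := by
    have h1 := congrArg (aeval s) (cyclotomic_prime_mul_X_sub_one (ZMod l) p)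
    rw [mul_comm, hfh] at h1
    ext v
    have h2 := LinearMap.congr_fun h1 v
    rw [map_mul] at h2
    simp only [map_sub, map_pow, aeval_X, map_one, Module.End.mul_apply, LinearMap.sub_apply,
      Module.End.one_apply, hspow, hσp, sub_self] at h2
    exact hfix _ (sub_eq_zero.1 h2)
  have hinv : ∀ q : (ZMod l)[X], ∀ v ∈ LinearMap.ker (aeval s q), σ v ∈ LinearMap.ker (aeval s q) := by
    intro q v hv
    rw [LinearMap.mem_ker] at hv ⊢
    have h1 : aeval s (q * X) v = aeval s (X * q) v := by rw [mul_comm]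
    rw [map_mul, map_mul, Module.End.mul_apply, Module.End.mul_apply, aeval_X, hv, map_zero] at h1
    exact h1
  have hsup := sup_ker_aeval_eq_ker_aeval_mul_of_coprime s hco
  rw [hcyc, LinearMap.ker_zero] at hsup
  have hcompl : IsCompl (LinearMap.ker (aeval s f)) (LinearMap.ker (aeval s h)) :=
    ⟨disjoint_ker_aeval_of_isCoprime s hco, codisjoint_iff.2 hsup⟩
  have hsum := Submodule.finrank_add_eq_of_isCompl hcompl
  rw [hdim] at hsum
  have hUd := hdvd _ (hinv f)
  have hWd := hdvd _ (hinv h)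
  have hne0 : ∀ a b : (ZMod l)[X], IsCompl (LinearMap.ker (aeval s a)) (LinearMap.ker (aeval s b)) →
      b ≠ 0 → b.natDegree = g → LinearMap.ker (aeval s a) ≠ ⊥ := by
    intro a b hab hb0 hb ha
    rw [ha] at hab
    have := eq_top_of_bot_isCompl hab
    exact hsmall b hb0 hb (LinearMap.ker_eq_top.1 this)
  have hU0 := hne0 f h hcompl hh0 hhd
  have hW0 := hne0 h f hcompl.symm hf0 hfd
  have hUp := Nat.le_of_dvd (Nat.pos_of_ne_zero (mt Submodule.finrank_eq_zero.1 hU0)) hUd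
  have hWp := Nat.le_of_dvd (Nat.pos_of_ne_zero (mt Submodule.finrank_eq_zero.1 hW0)) hWd
  have hirr : ∀ U : Submodule (ZMod l) V, Module.finrank (ZMod l) U = g →
      ∀ U' : Submodule (ZMod l) V, U' ≤ U → (∀ v ∈ U', σ v ∈ U') → U' = ⊥ ∨ U' = U := by
    intro U hU U' hle hU'
    rcases Nat.eq_zero_or_pos (Module.finrank (ZMod l) U') with h0 | hpos
    · exact Or.inl (Submodule.finrank_eq_zero.1 h0)
    · exact Or.inr (Submodule.eq_of_le_of_finrank_le hle
        (hU.trans_le (Nat.le_of_dvd hpos (hdvd U' hU'))))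
  refine ⟨LinearMap.ker (aeval s f), LinearMap.ker (aeval s h), hinv f, hinv h, by omega, by omega,
    ⟨hU0, hirr _ (by omega)⟩, ⟨hW0, hirr _ (by omega)⟩, hcompl, ?_⟩
  rintro ⟨e, he⟩
  have hcomm_aeval : ∀ (q : (ZMod l)[X]) (u : LinearMap.ker (aeval s f)),
      ∃ hm : aeval s q (u : V) ∈ LinearMap.ker (aeval s f),
        ((e ⟨aeval s q (u : V), hm⟩ : LinearMap.ker (aeval s h)) : V) = aeval s q (e u : V) := by
    intro q
    induction q using Polynomial.induction_on' with
    | add a b ha hb =>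
      intro u
      obtain ⟨h1, h1'⟩ := ha u
      obtain ⟨h2, h2'⟩ := hb u
      refine ⟨by rw [map_add]; exact Submodule.add_mem _ h1 h2, ?_⟩
      have : (⟨aeval s (a + b) (u : V), by rw [map_add]; exact Submodule.add_mem _ h1 h2⟩ :
        LinearMap.ker (aeval s f)) = ⟨_, h1⟩ + ⟨_, h2⟩ := Subtype.ext (by simp)
      rw [this, map_add, Submodule.coe_add, h1', h2', map_add, LinearMap.add_apply]
    | monomial n c =>
      induction n with
      | zero =>
        intro u
        have h0 : ∀ x : V, aeval s (monomial 0 c) x = c • x := by intro x; simp [aeval_monomial]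
        refine ⟨by rw [h0]; exact Submodule.smul_mem _ _ u.2, ?_⟩
        have : (⟨aeval s (monomial 0 c) (u : V), by rw [h0]; exact Submodule.smul_mem _ _ u.2⟩ :
          LinearMap.ker (aeval s f)) = c • u := Subtype.ext (h0 _)
        rw [this, map_smul, h0]; rfl
      | succ n ih =>
        intro u
        have h0 : ∀ x : V, aeval s (monomial (n + 1) c) x = aeval s (monomial n c) (σ x) := by
          intro x
          rw [← monomial_mul_X, map_mul, aeval_X]; rfl
        obtain ⟨h1, h1'⟩ := ih ⟨σ u, hinv f u u.2⟩
        refine ⟨by rw [h0]; exact h1, ?_⟩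
        rw [h0 (e u : V), ← he, ← h1']
        congr 2
        exact Subtype.ext (h0 _)
  apply hW0
  rw [eq_bot_iff]
  intro w hw
  obtain ⟨u, hu⟩ := e.surjective ⟨w, hw⟩
  obtain ⟨h1, h2⟩ := hcomm_aeval f u
  rw [hu] at h2
  have h3 : (⟨aeval s f (u : V), h1⟩ : LinearMap.ker (aeval s f)) = 0 := Subtype.ext u.2
  rw [h3, map_zero] at h2
  exact (Submodule.disjoint_def.1 hcompl.disjoint) w h2.symm hw
end

section
/- Let G be a finite group and H ≤ G a subgroup satisfying H ∩ gHg⁻¹ = {1} for every g ∈ G \ H. Let n = [G : H] be the index of H and suppose |G| = n(n−1) (equivalently |H| = n−1). Let d be a positive divisor of n−1 and let U ≤ G be a subgroup of order n(n−1)/d. Then U acts transitively on the coset space X = G/H (via left multiplication), and the stabilizer in U of the trivial coset H has exactly d orbits on X \ {H}. -/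
/-- Let `G` be a finite group and `H ≤ G` a subgroup satisfying
`H ∩ gHg⁻¹ = {1}` for every `g ∈ G \ H` (a Frobenius complement).  Let `n = [G : H]` and
suppose `|G| = n(n-1)`.  Let `d` be a positive divisor of `n-1` and `U ≤ G` a subgroup of
order `n(n-1)/d`.  Then `U` acts transitively on the coset space `X = G/H` and the
stabilizer in `U` of the trivial coset has exactly `d` orbits on `X \ {H}`. -/
theorem stmt7 {G : Type*} [Group G] [Finite G] (H : Subgroup G)
    (hFrob : ∀ g : G, g ∉ H → ∀ x : G, x ∈ H → g⁻¹ * x * g ∈ H → x = 1)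
    (n d : ℕ) (hn : H.index = n) (hG : Nat.card G = n * (n - 1))
    (hd : 0 < d) (hdvd : d ∣ n - 1)
    (U : Subgroup G) (hU : Nat.card U = n * (n - 1) / d) :
    MulAction.IsPretransitive U (G ⧸ H) ∧
      Nat.card {S : Set (G ⧸ H) // ∃ x : G ⧸ H, x ≠ ((1 : G) : G ⧸ H) ∧
        S = MulAction.orbit (MulAction.stabilizer U ((1 : G) : G ⧸ H)) x} = d := by
  classical
  have hGpos : 0 < Nat.card G := Nat.card_pos
  have hn2 : 2 ≤ n := by
    rcases n with _ | _ | n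
    · simp at hG; omega
    · simp at hG; omega
    · omega
  obtain ⟨m, hm⟩ := hdvd
  have hmpos : 0 < m := by
    rcases Nat.eq_zero_or_pos m with h | h
    · subst h; simp at hm; omega
    · exact h
  have hUm : Nat.card U = n * m := by
    rw [hU, hm, show n * (d * m) = d * (n * m) by ring, Nat.mul_div_cancel_left _ hd]
  have hcardX : Nat.card (G ⧸ H) = n := hn
  have hfinX : Finite (G ⧸ H) := inferInstance
  have hstabG : ∀ x : G ⧸ H, Nat.card (MulAction.stabilizer G x) = n - 1 := by
    intro x
    have h1 := MulAction.index_stabilizer G x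
    rw [MulAction.orbit_eq_univ, Set.ncard_univ, hcardX] at h1
    have h2 := (MulAction.stabilizer G x).card_mul_index
    rw [h1, hG, mul_comm] at h2
    exact Nat.eq_of_mul_eq_mul_left (by omega) h2
  have hstabU : ∀ x : G ⧸ H, Nat.card (MulAction.stabilizer U x) ∣ m := by
    intro x
    have h1 : Nat.card (MulAction.stabilizer U x) ∣ n - 1 := by
      rw [← hstabG x]
      let f : MulAction.stabilizer U x →* MulAction.stabilizer G x :=
        { toFun := fun u => ⟨((u : U) : G), u.2⟩
          map_one' := rfl
          map_mul' := fun _ _ => rfl }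
      refine Subgroup.card_dvd_of_injective f ?_
      intro a b hab
      apply Subtype.ext
      apply Subtype.ext
      exact congrArg (fun z : MulAction.stabilizer G x => (z : G)) hab
    have h2 : Nat.card (MulAction.stabilizer U x) ∣ n * m := by
      rw [← hUm]; exact Subgroup.card_subgroup_dvd_card _
    have hc : Nat.Coprime (n - 1) n := by
      obtain ⟨k, rfl⟩ : ∃ k, n = k + 1 := ⟨n - 1, by omega⟩
      simp
    exact (Nat.Coprime.coprime_dvd_left h1 hc).dvd_of_dvd_mul_left h2
  have horb : ∀ x : G ⧸ H, MulAction.orbit U x = Set.univ := by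
    intro x
    have h1 := MulAction.index_stabilizer U x
    have h2 := (MulAction.stabilizer U x).card_mul_index
    rw [h1, hUm] at h2
    have h3 := Nat.le_of_dvd hmpos (hstabU x)
    apply Set.eq_of_subset_of_ncard_le (Set.subset_univ _) _ (Set.toFinite _)
    rw [Set.ncard_univ, hcardX]
    by_contra hlt
    push Not at hlt
    have h4 := Nat.mul_le_mul_right (MulAction.orbit U x).ncard h3
    have h5 := Nat.mul_lt_mul_of_pos_left hlt hmpos
    rw [mul_comm n m] at h2
    omega
  refine ⟨⟨fun x y => ?_⟩, ?_⟩
  · have : y ∈ MulAction.orbit U x := by rw [horb x]; trivial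
    exact this
  have hK : Nat.card (MulAction.stabilizer U ((1 : G) : G ⧸ H)) = m := by
    have h1 := MulAction.index_stabilizer U ((1 : G) : G ⧸ H)
    rw [horb, Set.ncard_univ, hcardX] at h1
    have h2 := (MulAction.stabilizer U ((1 : G) : G ⧸ H)).card_mul_index
    rw [h1, hUm, mul_comm] at h2
    exact Nat.eq_of_mul_eq_mul_left (by omega) h2
  have hfree : ∀ x : G ⧸ H, x ≠ ((1 : G) : G ⧸ H) →
      (MulAction.orbit (MulAction.stabilizer U ((1 : G) : G ⧸ H)) x).ncard = m := by
    intro x hx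
    rw [← MulAction.index_stabilizer]
    have hbot : MulAction.stabilizer (MulAction.stabilizer U ((1 : G) : G ⧸ H)) x = ⊥ := by
      rw [eq_bot_iff]
      rintro u hu
      obtain ⟨g, rfl⟩ := QuotientGroup.mk_surjective x
      have hg : g ∉ H := by
        intro hg
        apply hx
        rw [QuotientGroup.eq]
        simpa using hg
      have hu1 : ((((u : U) : G) * 1 : G) : G ⧸ H) = ((1 : G) : G ⧸ H) := u.2
      have hu2 : ((((u : U) : G) * g : G) : G ⧸ H) = (g : G ⧸ H) := hu
      rw [eq_comm, QuotientGroup.eq] at hu1 hu2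
      have := hFrob g hg ((u : U) : G) (by simpa using hu1) (by simpa [mul_assoc] using hu2)
      rw [Subgroup.mem_bot]
      apply Subtype.ext
      apply Subtype.ext
      exact this
    rw [hbot, Subgroup.index_bot, hK]
  set K := MulAction.stabilizer U ((1 : G) : G ⧸ H) with hKdef
  have hone : ∀ k : K, k • ((1 : G) : G ⧸ H) = ((1 : G) : G ⧸ H) := fun k => k.2
  let Y := {x : G ⧸ H // x ≠ ((1 : G) : G ⧸ H)}
  let T := {S : Set (G ⧸ H) // ∃ x : G ⧸ H, x ≠ ((1 : G) : G ⧸ H) ∧ S = MulAction.orbit K x}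
  change Nat.card T = d
  let f : Y → T := fun y => ⟨MulAction.orbit K y.1, y.1, y.2, rfl⟩
  have hY : Nat.card Y = n - 1 := by
    have h := Set.ncard_compl ({((1 : G) : G ⧸ H)} : Set (G ⧸ H))
    rw [Set.ncard_singleton, hcardX] at h
    exact h
  have hfib : ∀ t : T, Nat.card {y : Y // f y = t} = m := by
    rintro ⟨S, x, hx, rfl⟩
    rw [← hfree x hx, ← Nat.card_coe_set_eq]
    have hne : ∀ z ∈ MulAction.orbit K x, z ≠ ((1 : G) : G ⧸ H) := by
      rintro _ ⟨k, rfl⟩ h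
      apply hx
      have h' : k • x = k • ((1 : G) : G ⧸ H) := by rw [hone]; exact h
      exact MulAction.injective k h'
    refine Nat.card_congr
      { toFun := fun y => ⟨y.1.1, ?_⟩
        invFun := fun z => ⟨⟨z.1, hne z.1 z.2⟩, ?_⟩
        left_inv := fun _ => rfl
        right_inv := fun _ => rfl }
    · have := congrArg Subtype.val y.2
      exact MulAction.orbit_eq_iff.1 this
    · exact Subtype.ext (MulAction.orbit_eq_iff.2 z.2)
  have hT : Finite T := inferInstanceAs (Finite (Subtype _))
  have hsum := Nat.card_congr (Equiv.sigmaFiberEquiv f)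
  have := Fintype.ofFinite T
  rw [Nat.card_sigma, hY, hm] at hsum
  simp only [hfib, Finset.sum_const, Finset.card_univ, smul_eq_mul] at hsum
  rw [Nat.card_eq_fintype_card]
  exact Nat.eq_of_mul_eq_mul_right hmpos hsum
end
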